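/- arXiv:math/0007152 — 4 statements merged into one kernel-verified Lean document; each statement's English description precedes it below -/
import Mathlib

section
/- The conic V(F₁) and the quartic V(Q₁) intersect in exactly one point of ℙ²: V(F₁) ∩ V(Q₁) = {[1:0:0]}. -/
noncomputable section

open MvPolynomial

/-- the complex projective plane -/
abbrev P2 := Projectivization ℂ (Fin 3 → ℂ)

instance : TopologicalSpace P2 :=
  inferInstanceAs (TopologicalSpace (Quotient (projectivizationSetoid ℂ (Fin 3 → ℂ))))

/-- the zero locus in ℙ² of a homogeneous polynomial F: the set of points all of whose
representative vectors are zeros of F -/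
def VV (F : MvPolynomial (Fin 3) ℂ) : Set P2 :=
  {P | ∀ (v : Fin 3 → ℂ) (h : v ≠ 0), Projectivization.mk ℂ v h = P → eval v F = 0}

/-- the singular locus of the curve {F = 0}: points at which all three partial
derivatives of F vanish (at every representative vector) -/
def SingLoc (F : MvPolynomial (Fin 3) ℂ) : Set P2 :=
  {P | ∀ (v : Fin 3 → ℂ) (h : v ≠ 0), Projectivization.mk ℂ v h = P →
    ∀ i : Fin 3, eval v (pderiv i F) = 0}

/-- the conic F₁ = 8z²−20yz+36xz+17y²−18xy -/
def F₁ : MvPolynomial (Fin 3) ℂ :=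
  8 * X 2 ^ 2 - 20 * X 1 * X 2 + 36 * X 0 * X 2 + 17 * X 1 ^ 2 - 18 * X 0 * X 1

/-- the quartic Q₁ = 8x²z²−16xy²z+52x²yz−36x³z−37x²y²+18x³y−y⁴+20xy³ -/
def Q₁ : MvPolynomial (Fin 3) ℂ :=
  8 * X 0 ^ 2 * X 2 ^ 2 - 16 * X 0 * X 1 ^ 2 * X 2 + 52 * X 0 ^ 2 * X 1 * X 2
    - 36 * X 0 ^ 3 * X 2 - 37 * X 0 ^ 2 * X 1 ^ 2 + 18 * X 0 ^ 3 * X 1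
    - X 1 ^ 4 + 20 * X 0 * X 1 ^ 3

/-- the conic F₂ = 3x²+2xy+108z² -/
def F₂ : MvPolynomial (Fin 3) ℂ :=
  3 * X 0 ^ 2 + 2 * X 0 * X 1 + 108 * X 2 ^ 2

/-- the quartic Q₂ = 2xy³+3x²y²+108y²z²−x⁴ -/
def Q₂ : MvPolynomial (Fin 3) ℂ :=
  2 * X 0 * X 1 ^ 3 + 3 * X 0 ^ 2 * X 1 ^ 2 + 108 * X 1 ^ 2 * X 2 ^ 2 - X 0 ^ 4

theorem v100_ne : (![1, 0, 0] : Fin 3 → ℂ) ≠ 0 := by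
  intro h; have := congrFun h 0; simp at this

theorem v010_ne : (![0, 1, 0] : Fin 3 → ℂ) ≠ 0 := by
  intro h; have := congrFun h 1; simp at this

theorem v001_ne : (![0, 0, 1] : Fin 3 → ℂ) ≠ 0 := by
  intro h; have := congrFun h 2; simp at this

theorem v110_ne : (![1, 1, 0] : Fin 3 → ℂ) ≠ 0 := by
  intro h; have := congrFun h 0; simp at this

theorem v1m10_ne : (![1, -1, 0] : Fin 3 → ℂ) ≠ 0 := by
  intro h; have := congrFun h 0; simp at this

/-- The only common zeros of `F₁` and `Q₁` in affine space lie on the line `y = z = 0`. -/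
theorem eq_zero_of_conic_of_quartic {x y z : ℂ}
    (hF : 8 * z ^ 2 - 20 * y * z + 36 * x * z + 17 * y ^ 2 - 18 * x * y = 0)
    (hQ : 8 * x ^ 2 * z ^ 2 - 16 * x * y ^ 2 * z + 52 * x ^ 2 * y * z - 36 * x ^ 3 * z
      - 37 * x ^ 2 * y ^ 2 + 18 * x ^ 3 * y - y ^ 4 + 20 * x * y ^ 3 = 0) :
    y = 0 ∧ z = 0 := by
  obtain ⟨a, ha⟩ : ∃ a, a = x * (-16 * y ^ 2 + 72 * x * y - 72 * x ^ 2) := ⟨_, rfl⟩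
  obtain ⟨b, hb⟩ : ∃ b, b = y * (-y ^ 3 + 20 * x * y ^ 2 - 54 * x ^ 2 * y + 36 * x ^ 3) :=
    ⟨_, rfl⟩
  have hlin : a * z + b = 0 := by
    rw [ha, hb]
    linear_combination hQ - x ^ 2 * hF
  have hres : 8 * b ^ 2 - (36 * x - 20 * y) * a * b + (17 * y ^ 2 - 18 * x * y) * a ^ 2 = 0 := by
    linear_combination a ^ 2 * hF - (8 * (a * z - b) + (36 * x - 20 * y) * a) * hlin
  have hy : y = 0 := by
    have h : y ^ 8 = 0 := by
      rw [ha, hb] at hres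
      linear_combination hres / 8
    exact pow_eq_zero_iff (by norm_num) |>.mp h
  subst hy
  refine ⟨rfl, ?_⟩
  have hxz : x ^ 3 * z = 0 := by linear_combination (x ^ 2 * hF - hQ) / 72
  rcases mul_eq_zero.mp hxz with hx | hz
  · have hx : x = 0 := pow_eq_zero_iff (by norm_num) |>.mp hx
    subst hx
    have h : z ^ 2 = 0 := by linear_combination hF / 8
    exact pow_eq_zero_iff (by norm_num) |>.mp h
  · exact hz

/-- The conic V(F₁) and the quartic V(Q₁) intersect in exactly one point of ℙ²:
V(F₁) ∩ V(Q₁) = {[1:0:0]}. -/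
theorem stmt_9 :
    VV F₁ ∩ VV Q₁ = {Projectivization.mk ℂ ![1, 0, 0] v100_ne} := by
  ext P
  simp only [Set.mem_inter_iff, Set.mem_singleton_iff]
  constructor
  · induction P using Projectivization.ind with
    | h v hv =>
    rintro ⟨hF, hQ⟩
    have hF := hF v hv rfl
    have hQ := hQ v hv rfl
    simp only [F₁, Q₁, map_add, map_sub, map_mul, map_pow, eval_X, map_ofNat] at hF hQ
    obtain ⟨hy, hz⟩ := eq_zero_of_conic_of_quartic hF hQ
    rw [Projectivization.mk_eq_mk_iff']
    refine ⟨v 0, ?_⟩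
    ext i
    fin_cases i <;> simp [hy, hz]
  · rintro rfl
    constructor <;>
    · intro v hv h
      obtain ⟨c, rfl⟩ := (Projectivization.mk_eq_mk_iff' ℂ _ _ _ _).mp h
      simp [F₁, Q₁]
end
end

section
/- The singular locus of the quartic Q₁ consists of exactly the two points [0:0:1] and [1:1:0]; that is, the set of points of ℙ² at which all three partial derivatives ∂Q₁/∂x, ∂Q₁/∂y, ∂Q₁/∂z vanish equals {[0:0:1], [1:1:0]}. -/
noncomputable section

open MvPolynomial

theorem eval_pderiv_Q₁ (v : Fin 3 → ℂ) :
    eval v (pderiv 0 Q₁) = 16 * v 0 * v 2 ^ 2 - 16 * v 1 ^ 2 * v 2 + 104 * v 0 * v 1 * v 2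
      - 108 * v 0 ^ 2 * v 2 - 74 * v 0 * v 1 ^ 2 + 54 * v 0 ^ 2 * v 1 + 20 * v 1 ^ 3 ∧
    eval v (pderiv 1 Q₁) = -32 * v 0 * v 1 * v 2 + 52 * v 0 ^ 2 * v 2 - 74 * v 0 ^ 2 * v 1
      + 18 * v 0 ^ 3 - 4 * v 1 ^ 3 + 60 * v 0 * v 1 ^ 2 ∧
    eval v (pderiv 2 Q₁) = 16 * v 0 ^ 2 * v 2 - 16 * v 0 * v 1 ^ 2 + 52 * v 0 ^ 2 * v 1
      - 36 * v 0 ^ 3 := by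
  have pderiv_ofNat (i : Fin 3) (n : ℕ) [n.AtLeastTwo] :
      pderiv i (OfNat.ofNat n : MvPolynomial (Fin 3) ℂ) = 0 :=
    (pderiv i).map_natCast n
  refine ⟨?_, ?_, ?_⟩ <;>
  · simp [Q₁, Derivation.leibniz, Derivation.leibniz_pow, pderiv_X,
      pderiv_ofNat]
    ring

/-- In the chart `x = 1`, the only common zero of the partial derivatives of `Q₁` is `(1, 0)`. -/
theorem eq_one_and_eq_zero_of_partials_eq_zero {t s : ℂ}
    (h0 : 16 * s ^ 2 - 16 * t ^ 2 * s + 104 * t * s - 108 * s - 74 * t ^ 2 + 54 * t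
      + 20 * t ^ 3 = 0)
    (h1 : -32 * t * s + 52 * s - 74 * t + 18 - 4 * t ^ 3 + 60 * t ^ 2 = 0)
    (h2 : 16 * s - 16 * t ^ 2 + 52 * t - 36 = 0) : t = 1 ∧ s = 0 := by
  obtain rfl : s = (t - 1) * (t - 9 / 4) := by linear_combination h2 / 16
  suffices ht : t = 1 by simp [ht]
  by_contra ht
  have ht' : t - 1 ≠ 0 := sub_ne_zero.mpr ht
  have hg : t ^ 2 - 6 * t + 9 / 2 = 0 := by
    apply (mul_eq_zero.mp _).resolve_left (pow_ne_zero 2 ht')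
    linear_combination -(h0 + t * h1) / 36
  have h3 : t - 3 = 0 := by
    apply (mul_eq_zero.mp _).resolve_left (pow_ne_zero 2 ht')
    linear_combination -h1 / 18 - (t - 1) * hg
  obtain rfl : t = 3 := sub_eq_zero.mp h3
  norm_num at hg

/-- The singular locus of the quartic Q₁ consists of exactly the two points
[0:0:1] and [1:1:0]. -/
theorem stmt_10 :
    SingLoc Q₁ = {Projectivization.mk ℂ ![0, 0, 1] v001_ne,
      Projectivization.mk ℂ ![1, 1, 0] v110_ne} := by
  ext P
  simp only [SingLoc, Set.mem_ofPred_eq, Set.mem_insert_iff, Set.mem_singleton_iff]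
  constructor
  · intro hP
    induction P using Projectivization.ind with | h v hv
    have h := hP v hv rfl
    obtain ⟨e0, e1, e2⟩ := eval_pderiv_Q₁ v
    have h0 := e0.symm.trans (h 0)
    have h1 := e1.symm.trans (h 1)
    have h2 := e2.symm.trans (h 2)
    rw [Projectivization.mk_eq_mk_iff', Projectivization.mk_eq_mk_iff']
    by_cases hx : v 0 = 0
    · have hy : v 1 = 0 := by simpa [hx] using h1
      refine Or.inl ⟨v 2, ?_⟩
      ext i
      fin_cases i <;> simp [hx, hy]
    · obtain ⟨t, ht⟩ : ∃ t, v 1 = v 0 * t := ⟨v 1 / v 0, by field_simp⟩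
      obtain ⟨s, hs⟩ : ∃ s, v 2 = v 0 * s := ⟨v 2 / v 0, by field_simp⟩
      rw [ht, hs] at h0 h1
      rw [ht, hs] at h2
      have hx3 := pow_ne_zero 3 hx
      obtain ⟨rfl, rfl⟩ : t = 1 ∧ s = 0 := by
        apply eq_one_and_eq_zero_of_partials_eq_zero <;>
          apply (mul_eq_zero.mp _).resolve_left hx3
        · linear_combination h0
        · linear_combination h1
        · linear_combination h2
      refine Or.inr ⟨v 0, ?_⟩
      ext i
      fin_cases i <;> simp [ht, hs]
  · intro hP v hv hvP
    obtain ⟨e0, e1, e2⟩ := eval_pderiv_Q₁ v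
    rw [← hvP, Projectivization.mk_eq_mk_iff', Projectivization.mk_eq_mk_iff'] at hP
    rw [Fin.forall_fin_succ, Fin.forall_fin_two]
    change eval v (pderiv 0 Q₁) = 0 ∧ eval v (pderiv 1 Q₁) = 0 ∧ eval v (pderiv 2 Q₁) = 0
    rw [e0, e1, e2]
    rcases hP with ⟨a, rfl⟩ | ⟨a, rfl⟩ <;> refine ⟨?_, ?_, ?_⟩ <;> simp <;> ring
end
end

section
/- The conic V(F₂) and the quartic V(Q₂) intersect in exactly one point of ℙ²: V(F₂) ∩ V(Q₂) = {[0:1:0]}. -/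
noncomputable section

open MvPolynomial

theorem eval_F₂ (v : Fin 3 → ℂ) :
    eval v F₂ = 3 * v 0 ^ 2 + 2 * v 0 * v 1 + 108 * v 2 ^ 2 := by
  simp [F₂]

/-- The quartic Q₂ is y²F₂ − x⁴. -/
theorem Q₂_eq : Q₂ = X 1 ^ 2 * F₂ - X 0 ^ 4 := by
  unfold Q₂ F₂
  ring

/-- On affine cones, F₂ and Q₂ vanish simultaneously exactly along the y-axis. -/
theorem eval_F₂_eq_zero_and_eval_Q₂_eq_zero_iff (v : Fin 3 → ℂ) :
    eval v F₂ = 0 ∧ eval v Q₂ = 0 ↔ v 0 = 0 ∧ v 2 = 0 := by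
  constructor
  · rintro ⟨hF, hQ⟩
    have h0 : v 0 = 0 := by simpa [Q₂_eq, hF] using hQ
    exact ⟨h0, by simpa [eval_F₂, h0] using hF⟩
  · rintro ⟨h0, h2⟩
    simp [Q₂_eq, eval_F₂, h0, h2]

theorem mk_eq_mk_010_iff (v : Fin 3 → ℂ) (hv : v ≠ 0) :
    Projectivization.mk ℂ v hv = Projectivization.mk ℂ ![0, 1, 0] v010_ne ↔
      v 0 = 0 ∧ v 2 = 0 := by
  rw [Projectivization.mk_eq_mk_iff']
  constructor
  · rintro ⟨a, rfl⟩
    simp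
  · rintro ⟨h0, h2⟩
    refine ⟨v 1, ?_⟩
    ext i
    fin_cases i <;> simp [h0, h2]

/-- The conic V(F₂) and the quartic V(Q₂) intersect in exactly one point of ℙ²:
V(F₂) ∩ V(Q₂) = {[0:1:0]}. -/
theorem stmt_13 :
    VV F₂ ∩ VV Q₂ = {Projectivization.mk ℂ ![0, 1, 0] v010_ne} := by
  ext P
  rw [Set.mem_singleton_iff]
  constructor
  · rintro ⟨hF, hQ⟩
    induction P using Projectivization.ind with
    | h v hv =>
      rw [mk_eq_mk_010_iff, ← eval_F₂_eq_zero_and_eval_Q₂_eq_zero_iff]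
      exact ⟨hF v hv rfl, hQ v hv rfl⟩
  · rintro rfl
    have key (v : Fin 3 → ℂ) (hv : v ≠ 0)
        (h : Projectivization.mk ℂ v hv = Projectivization.mk ℂ ![0, 1, 0] v010_ne) :=
      (eval_F₂_eq_zero_and_eval_Q₂_eq_zero_iff v).2 ((mk_eq_mk_010_iff v hv).1 h)
    exact ⟨fun v hv h => (key v hv h).1, fun v hv h => (key v hv h).2⟩
end
end

section
/- There exist two irreducible homogeneous cubic polynomials F, G ∈ ℂ[x,y,z] such that: (i) each of the curves V(F) and V(G) has exactly one singular point, and that singular point is a node; (ii) V(F) ∩ V(G) = {P₁, P′} consists of exactly two distinct points, both of which are smooth points of V(F) and of V(G); (iii) at P₁ the gradients of F and of G (at a common representative vector) are proportional, and likewise at P′, so the two cubics are mutually tangent at both intersection points; and (iv) the common tangent line at P′ contains the point P₁, i.e. ⟨∇F(p′), p₁⟩ = 0 for representatives p′ of P′ and p₁ of P₁. -/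
noncomputable section

open MvPolynomial

/-- gradient vector of F at the point v ∈ ℂ³ -/
def gradP (F : MvPolynomial (Fin 3) ℂ) (v : Fin 3 → ℂ) : Fin 3 → ℂ :=
  fun i => eval v (pderiv i F)

/-- Hessian matrix of second partial derivatives of F at v -/
def hess (F : MvPolynomial (Fin 3) ℂ) (v : Fin 3 → ℂ) : Matrix (Fin 3) (Fin 3) ℂ :=
  fun i j => eval v (pderiv i (pderiv j F))

/-- P is a node of the curve V(F): P is a singular point and the Hessian of F at
(every) representative vector of P has rank 2 -/
def IsNode (F : MvPolynomial (Fin 3) ℂ) (P : P2) : Prop :=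
  P ∈ SingLoc F ∧ ∀ (v : Fin 3 → ℂ) (h : v ≠ 0), Projectivization.mk ℂ v h = P →
    (hess F v).rank = 2

/-- the pencil of cubics x²y + y²z − 7yz² − 6xz² + ez³ generated by a nodal cubic and the
triple of one of its tangent lines z = 0 -/
def pencilCubic (e : ℂ) : MvPolynomial (Fin 3) ℂ :=
  X 0 ^ 2 * X 1 + X 1 ^ 2 * X 2 - 7 * X 1 * X 2 ^ 2 - 6 * X 0 * X 2 ^ 2 + C e * X 2 ^ 3

theorem eval_pencilCubic (e : ℂ) (v : Fin 3 → ℂ) :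
    eval v (pencilCubic e) =
      v 0 ^ 2 * v 1 + v 1 ^ 2 * v 2 - 7 * v 1 * v 2 ^ 2 - 6 * v 0 * v 2 ^ 2 + e * v 2 ^ 3 := by
  simp [pencilCubic]

theorem pencilCubic_isHomogeneous (e : ℂ) : (pencilCubic e).IsHomogeneous 3 := by
  have h (i : Fin 3) : (X i : MvPolynomial (Fin 3) ℂ).IsHomogeneous 1 := isHomogeneous_X _ _
  have hC (c : ℂ) : (C c : MvPolynomial (Fin 3) ℂ).IsHomogeneous 0 := isHomogeneous_C _ _
  exact (((((h 0).pow 2).mul (h 1)).add (((h 1).pow 2).mul (h 2))).sub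
    (((hC 7).mul (h 1)).mul ((h 2).pow 2))).sub (((hC 6).mul (h 0)).mul ((h 2).pow 2)) |>.add
    ((hC e).mul ((h 2).pow 3))

theorem pderiv_pencilCubic_zero (e : ℂ) :
    pderiv 0 (pencilCubic e) = 2 * X 0 * X 1 - 6 * X 2 ^ 2 := by
  simp [pencilCubic, pderiv_X, Derivation.leibniz_pow, ← map_ofNat C]
  ring

theorem pderiv_pencilCubic_one (e : ℂ) :
    pderiv 1 (pencilCubic e) = X 0 ^ 2 + 2 * X 1 * X 2 - 7 * X 2 ^ 2 := by
  simp [pencilCubic, pderiv_X, Derivation.leibniz_pow, ← map_ofNat C]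
  ring

theorem pderiv_pencilCubic_two (e : ℂ) :
    pderiv 2 (pencilCubic e) =
      X 1 ^ 2 - 14 * X 1 * X 2 - 12 * X 0 * X 2 + 3 * C e * X 2 ^ 2 := by
  simp [pencilCubic, pderiv_X, Derivation.leibniz_pow, ← map_ofNat C]
  simp only [map_ofNat]
  ring

theorem gradP_pencilCubic (e : ℂ) (v : Fin 3 → ℂ) :
    gradP (pencilCubic e) v =
      ![2 * v 0 * v 1 - 6 * v 2 ^ 2, v 0 ^ 2 + 2 * v 1 * v 2 - 7 * v 2 ^ 2,
        v 1 ^ 2 - 14 * v 1 * v 2 - 12 * v 0 * v 2 + 3 * e * v 2 ^ 2] := by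
  ext i
  fin_cases i <;>
    simp [gradP, pderiv_pencilCubic_zero, pderiv_pencilCubic_one, pderiv_pencilCubic_two]

theorem hess_pencilCubic (e : ℂ) (v : Fin 3 → ℂ) :
    hess (pencilCubic e) v =
      !![2 * v 1, 2 * v 0, -12 * v 2;
        2 * v 0, 2 * v 2, 2 * v 1 - 14 * v 2;
        -12 * v 2, 2 * v 1 - 14 * v 2, -14 * v 1 - 12 * v 0 + 6 * e * v 2] := by
  ext i j
  fin_cases i <;> fin_cases j <;>
    simp [hess, pderiv_pencilCubic_zero, pderiv_pencilCubic_one, pderiv_pencilCubic_two,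
      pderiv_X, Derivation.leibniz_pow, ← map_ofNat C] <;>
    ring

theorem pencilCubic_irreducible (e : ℂ) : Irreducible (pencilCubic e) := by
  rw [← MulEquiv.irreducible_iff (finSuccEquiv ℂ 2)]
  set a : MvPolynomial (Fin 2) ℂ := X 0
  set b : MvPolynomial (Fin 2) ℂ := -6 * X 1 ^ 2
  set c : MvPolynomial (Fin 2) ℂ := X 1 * (X 0 ^ 2 - 7 * X 0 * X 1 + C e * X 1 ^ 2)
  have hf : finSuccEquiv ℂ 2 (pencilCubic e) =
      Polynomial.C a * Polynomial.X ^ 2 + Polynomial.C b * Polynomial.X + Polynomial.C c := by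
    have h1 : finSuccEquiv ℂ 2 (X 1) = Polynomial.C (X 0) := finSuccEquiv_X_succ (j := 0)
    have h2 : finSuccEquiv ℂ 2 (X 2) = Polynomial.C (X 1) := finSuccEquiv_X_succ (j := 1)
    have hC : finSuccEquiv ℂ 2 (C e) = Polynomial.C (C e) := by simp [finSuccEquiv_apply]
    simp only [pencilCubic, map_add, map_sub, map_mul, map_pow, map_ofNat, map_neg, a, b, c,
      finSuccEquiv_X_zero, h1, h2, hC]
    ring
  have ha : a ≠ 0 := X_ne_zero _
  have hX : Prime (X 1 : MvPolynomial (Fin 2) ℂ) := X_prime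
  have not_dvd (p : MvPolynomial (Fin 2) ℂ) (hp : eval ![1, 0] p ≠ 0) : ¬ X 1 ∣ p := by
    rintro ⟨q, rfl⟩
    simp at hp
  have hdeg := Polynomial.degree_quadratic (b := b) (c := c) ha
  rw [hf]
  refine Polynomial.irreducible_of_eisenstein_criterion
    (P := Ideal.span {(X 1 : MvPolynomial (Fin 2) ℂ)})
    ((Ideal.span_singleton_prime hX.ne_zero).2 hX) ?_ ?_ ?_ ?_ ?_
  · rw [Polynomial.leadingCoeff_quadratic ha, Ideal.mem_span_singleton]
    exact not_dvd _ (by simp [a])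
  · intro n hn
    rw [hdeg] at hn
    have hn2 : n < 2 := by exact_mod_cast hn
    rw [Ideal.mem_span_singleton]
    interval_cases n
    · simp [c]
    · have hb : X 1 ∣ b := dvd_mul_of_dvd_right (dvd_pow_self _ two_ne_zero) _
      simpa [Polynomial.coeff_X, Polynomial.coeff_C] using hb
  · rw [hdeg]
    norm_num
  · rw [Ideal.span_singleton_pow, Ideal.mem_span_singleton]
    have h0 : (Polynomial.C a * Polynomial.X ^ 2 + Polynomial.C b * Polynomial.X +
      Polynomial.C c).coeff 0 = c := by simp
    rw [h0, pow_two]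
    simp only [c]
    rw [mul_dvd_mul_iff_left hX.ne_zero]
    exact not_dvd _ (by simp)
  · intro r hr
    rw [Polynomial.C_dvd_iff_dvd_coeff] at hr
    have hra : r ∣ X 0 := by simpa [a, Polynomial.coeff_X, Polynomial.coeff_C] using hr 2
    have hrb : r ∣ b := by simpa [Polynomial.coeff_X, Polynomial.coeff_C] using hr 1
    obtain hu | has := (X_prime (R := ℂ) (i := (0 : Fin 2))).irreducible.dvd_iff.1 hra
    · exact hu
    · obtain ⟨q, hq⟩ := has.dvd.trans hrb
      simpa [b] using congrArg (eval ![0, 1]) hq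

theorem exists_smul_of_mk_eq {v w : Fin 3 → ℂ} {hv : v ≠ 0} {hw : w ≠ 0}
    (h : Projectivization.mk ℂ v hv = Projectivization.mk ℂ w hw) :
    ∃ t : ℂ, t ≠ 0 ∧ v = t • w := by
  obtain ⟨t, rfl⟩ := (Projectivization.mk_eq_mk_iff' ℂ v w hv hw).1 h
  exact ⟨t, (smul_ne_zero_iff.1 hv).1, rfl⟩

theorem eval_smul_of_isHomogeneous {σ R : Type*} [CommSemiring R] {F : MvPolynomial σ R} {n : ℕ}
    (hF : F.IsHomogeneous n) (t : R) (v : σ → R) :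
    eval (t • v) F = t ^ n * eval v F := by
  rw [eval_eq, eval_eq, Finset.mul_sum]
  refine Finset.sum_congr rfl fun d hd => ?_
  have hdeg : ∑ i ∈ d.support, d i = n := by
    simpa [Finsupp.weight_apply, Finsupp.sum] using hF (mem_support_iff.1 hd)
  simp only [Pi.smul_apply, smul_eq_mul, mul_pow, Finset.prod_mul_distrib,
    Finset.prod_pow_eq_pow_sum, hdeg]
  ring

theorem mk_mem_VV {F : MvPolynomial (Fin 3) ℂ} {n : ℕ} (hF : F.IsHomogeneous n)
    (w : Fin 3 → ℂ) (hw : w ≠ 0) : Projectivization.mk ℂ w hw ∈ VV F ↔ eval w F = 0 := by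
  refine ⟨fun h => h w hw rfl, fun h v hv hvw => ?_⟩
  obtain ⟨t, -, rfl⟩ := exists_smul_of_mk_eq hvw
  rw [eval_smul_of_isHomogeneous hF, h, mul_zero]

theorem mk_mem_SingLoc {F : MvPolynomial (Fin 3) ℂ} {n : ℕ} (hF : F.IsHomogeneous n)
    (w : Fin 3 → ℂ) (hw : w ≠ 0) : Projectivization.mk ℂ w hw ∈ SingLoc F ↔ gradP F w = 0 := by
  refine ⟨fun h => funext (h w hw rfl), fun h v hv hvw i => ?_⟩
  obtain ⟨t, -, rfl⟩ := exists_smul_of_mk_eq hvw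
  rw [eval_smul_of_isHomogeneous hF.pderiv,
    show eval w (pderiv i F) = 0 from congrFun h i, mul_zero]

theorem rank_eq_two_of_row_eq {K : Type*} [Field K] (M : Matrix (Fin 3) (Fin 3) K) (a b : K)
    (h : ∀ j, M 2 j = a * M 0 j + b * M 1 j) (hdet : M 0 0 * M 1 1 - M 0 1 * M 1 0 ≠ 0) :
    M.rank = 2 := by
  apply le_antisymm
  · have hM : M = !![1, 0; 0, 1; a, b] * M.submatrix ![0, 1] id := by
      ext i j
      rw [Matrix.mul_apply, Fin.sum_univ_two]
      fin_cases i <;> simp [h]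
    rw [hM]
    exact (Matrix.rank_mul_le_left _ _).trans (Matrix.rank_le_width _)
  · have hs : (M.submatrix ![0, 1] ![0, 1]).rank = 2 := by
      rw [Matrix.rank_of_det_ne_zero (by rwa [Matrix.det_fin_two])]
      rfl
    rw [← hs]
    exact Matrix.rank_submatrix_le _ _ _

/-- a singular point (a : b : 1) of a member of the pencil that is the only one is a node -/
theorem pencilCubic_singLoc_isNode {e a b : ℂ} (hw : ![a, b, 1] ≠ 0)
    (h0 : a * b = 3) (h1 : a ^ 2 + 2 * b = 7) (h2 : b ^ 2 - 14 * b - 12 * a + 3 * e = 0)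
    (hdet : b ≠ a ^ 2)
    (huniq : ∀ x y : ℂ, x * y = 3 → x ^ 2 + 2 * y = 7 →
      y ^ 2 - 14 * y - 12 * x + 3 * e = 0 → x = a ∧ y = b) :
    SingLoc (pencilCubic e) = {Projectivization.mk ℂ ![a, b, 1] hw} ∧
      IsNode (pencilCubic e) (Projectivization.mk ℂ ![a, b, 1] hw) := by
  have hmem : Projectivization.mk ℂ ![a, b, 1] hw ∈ SingLoc (pencilCubic e) := by
    rw [mk_mem_SingLoc (pencilCubic_isHomogeneous e), gradP_pencilCubic]
    ext i
    fin_cases i <;> simp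
    · linear_combination 2 * h0
    · linear_combination h1
    · linear_combination h2
  refine ⟨Set.eq_singleton_iff_unique_mem.2 ⟨hmem, fun P => ?_⟩, hmem, fun v hv hvw => ?_⟩
  · induction P using Projectivization.ind with
    | h v hv =>
      rw [mk_mem_SingLoc (pencilCubic_isHomogeneous e), gradP_pencilCubic]
      intro h
      have g0 : 2 * v 0 * v 1 - 6 * v 2 ^ 2 = 0 := congrFun h 0
      have g1 : v 0 ^ 2 + 2 * v 1 * v 2 - 7 * v 2 ^ 2 = 0 := congrFun h 1
      have g2 : v 1 ^ 2 - 14 * v 1 * v 2 - 12 * v 0 * v 2 + 3 * e * v 2 ^ 2 = 0 := congrFun h 2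
      have hz : v 2 ≠ 0 := by
        intro hz
        simp only [hz] at g1 g2
        apply hv
        ext i
        fin_cases i
        · simpa using g1
        · simpa using g2
        · exact hz
      obtain ⟨hx, hy⟩ := huniq (v 0 / v 2) (v 1 / v 2)
        (by field_simp; linear_combination g0 / 2)
        (by field_simp; linear_combination g1)
        (by field_simp; linear_combination g2)
      rw [Projectivization.mk_eq_mk_iff']
      refine ⟨v 2, ?_⟩
      ext i
      fin_cases i
      · simp [← hx, mul_div_cancel₀ _ hz]
      · simp [← hy, mul_div_cancel₀ _ hz]
      · simp
  · obtain ⟨t, ht, rfl⟩ := exists_smul_of_mk_eq hvw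
    apply rank_eq_two_of_row_eq _ (-a) (-b)
    · intro j
      rw [hess_pencilCubic]
      fin_cases j <;> simp
      · linear_combination 4 * t * h0
      · linear_combination 2 * t * h1
      · linear_combination 2 * t * h2
    · rw [hess_pencilCubic]
      simp
      intro h
      apply hdet
      apply mul_left_cancel₀ (pow_ne_zero 2 ht)
      linear_combination h / 4

theorem abscissa_cases {x y : ℂ} (h0 : x * y = 3) (h1 : x ^ 2 + 2 * y = 7) :
    (x = 1 ∧ y = 3) ∨ (x = 2 ∧ y = 3 / 2) ∨ (x = -3 ∧ y = -1) := by
  have h : (x - 1) * ((x - 2) * (x + 3)) = 0 := by linear_combination x * h1 - 2 * h0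
  have hy : y = (7 - x ^ 2) / 2 := by linear_combination h1 / 2
  rcases mul_eq_zero.1 h with h | h
  · obtain rfl : x = 1 := by linear_combination h
    norm_num [hy]
  rcases mul_eq_zero.1 h with h | h
  · obtain rfl : x = 2 := by linear_combination h
    norm_num [hy]
  · obtain rfl : x = -3 := by linear_combination h
    norm_num [hy]

/-- There exist two irreducible homogeneous nodal cubics F, G meeting in exactly two
distinct points P₁, P′, both smooth on each cubic, with proportional gradients (mutual
tangency) at both points, and such that the common tangent line at P′ contains P₁. -/
theorem stmt_18 :
    ∃ (F G : MvPolynomial (Fin 3) ℂ) (NF NG P₁ P' : P2),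
      F.IsHomogeneous 3 ∧ G.IsHomogeneous 3 ∧ Irreducible F ∧ Irreducible G ∧
      SingLoc F = {NF} ∧ IsNode F NF ∧
      SingLoc G = {NG} ∧ IsNode G NG ∧
      P₁ ≠ P' ∧ VV F ∩ VV G = {P₁, P'} ∧
      P₁ ∉ SingLoc F ∧ P₁ ∉ SingLoc G ∧ P' ∉ SingLoc F ∧ P' ∉ SingLoc G ∧
      (∀ (v : Fin 3 → ℂ) (h : v ≠ 0), Projectivization.mk ℂ v h = P₁ →
        ∃ c : ℂ, c ≠ 0 ∧ gradP G v = c • gradP F v) ∧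
      (∀ (v : Fin 3 → ℂ) (h : v ≠ 0), Projectivization.mk ℂ v h = P' →
        ∃ c : ℂ, c ≠ 0 ∧ gradP G v = c • gradP F v) ∧
      (∀ (p' : Fin 3 → ℂ) (h' : p' ≠ 0), Projectivization.mk ℂ p' h' = P' →
        ∀ (p₁ : Fin 3 → ℂ) (h₁ : p₁ ≠ 0), Projectivization.mk ℂ p₁ h₁ = P₁ →
          ∑ i, gradP F p' i * p₁ i = 0) := by
  have hN : (![1, 3, 1] : Fin 3 → ℂ) ≠ 0 := fun h => by simpa using congrFun h 2
  have hM : (![-3, -1, 1] : Fin 3 → ℂ) ≠ 0 := fun h => by simpa using congrFun h 2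
  have hp : (![1, 0, 0] : Fin 3 → ℂ) ≠ 0 := fun h => by simpa using congrFun h 0
  have hq : (![0, 1, 0] : Fin 3 → ℂ) ≠ 0 := fun h => by simpa using congrFun h 1
  have hF := pencilCubic_isHomogeneous 15
  have hG := pencilCubic_isHomogeneous (-17)
  obtain ⟨hF1, hF2⟩ := pencilCubic_singLoc_isNode (e := 15) hN (by norm_num) (by norm_num)
    (by norm_num) (by norm_num) (by
      intro x y h0 h1 h2
      rcases abscissa_cases h0 h1 with h | ⟨rfl, rfl⟩ | ⟨rfl, rfl⟩
      · exact h
      · norm_num at h2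
      · norm_num at h2)
  obtain ⟨hG1, hG2⟩ := pencilCubic_singLoc_isNode (e := -17) hM (by norm_num) (by norm_num)
    (by norm_num) (by norm_num) (by
      intro x y h0 h1 h2
      rcases abscissa_cases h0 h1 with ⟨rfl, rfl⟩ | ⟨rfl, rfl⟩ | h
      · norm_num at h2
      · norm_num at h2
      · exact h)
  have smooth_p (e : ℂ) : Projectivization.mk ℂ ![1, 0, 0] hp ∉ SingLoc (pencilCubic e) := by
    rw [mk_mem_SingLoc (pencilCubic_isHomogeneous e), gradP_pencilCubic]
    exact fun h => by simpa using congrFun h 1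
  have smooth_q (e : ℂ) : Projectivization.mk ℂ ![0, 1, 0] hq ∉ SingLoc (pencilCubic e) := by
    rw [mk_mem_SingLoc (pencilCubic_isHomogeneous e), gradP_pencilCubic]
    exact fun h => by simpa using congrFun h 2
  have tangent (v : Fin 3 → ℂ) (hv : v 2 = 0) :
      ∃ c : ℂ, c ≠ 0 ∧ gradP (pencilCubic (-17)) v = c • gradP (pencilCubic 15) v :=
    ⟨1, one_ne_zero, by simp [gradP_pencilCubic, hv]⟩
  refine ⟨pencilCubic 15, pencilCubic (-17), _, _, Projectivization.mk ℂ ![1, 0, 0] hp,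
    Projectivization.mk ℂ ![0, 1, 0] hq, hF, hG, pencilCubic_irreducible _,
    pencilCubic_irreducible _, hF1, hF2, hG1, hG2, ?_, ?_, smooth_p _, smooth_p _, smooth_q _,
    smooth_q _, ?_, ?_, ?_⟩
  · intro h
    obtain ⟨t, -, ht⟩ := exists_smul_of_mk_eq h
    simpa using congrFun ht 0
  · ext P
    induction P using Projectivization.ind with
    | h v hv =>
      simp only [Set.mem_inter_iff, mk_mem_VV hF, mk_mem_VV hG, eval_pencilCubic,
        Set.mem_insert_iff, Set.mem_singleton_iff]
      constructor
      · rintro ⟨h1, h2⟩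
        have hz : v 2 = 0 := by
          refine eq_zero_of_pow_eq_zero (n := 3) ?_
          linear_combination (h1 - h2) / 32
        have hxy : v 0 = 0 ∨ v 1 = 0 := by simpa [hz] using h1
        rcases hxy with hx | hy
        · right
          rw [Projectivization.mk_eq_mk_iff']
          refine ⟨v 1, ?_⟩
          ext i
          fin_cases i <;> simp [hx, hz]
        · left
          rw [Projectivization.mk_eq_mk_iff']
          refine ⟨v 0, ?_⟩
          ext i
          fin_cases i <;> simp [hy, hz]
      · rintro (h | h)
        all_goals
          obtain ⟨t, -, rfl⟩ := exists_smul_of_mk_eq h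
          simp
  · intro v hv h
    obtain ⟨t, -, rfl⟩ := exists_smul_of_mk_eq h
    exact tangent _ (by simp)
  · intro v hv h
    obtain ⟨t, -, rfl⟩ := exists_smul_of_mk_eq h
    exact tangent _ (by simp)
  · intro v hv h w hw h'
    obtain ⟨t, -, rfl⟩ := exists_smul_of_mk_eq h
    obtain ⟨s, -, rfl⟩ := exists_smul_of_mk_eq h'
    simp [gradP_pencilCubic, Fin.sum_univ_three]
end
end
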